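/- Let A(Γ₀) be a dihedral Artin-Tits group with m < ∞, let w be a non-empty word in Ω(Γ₀), and let (v₁,…,v_k) be the ⋆-decomposition of w. If the word w' is obtained from w by a single operation of type 2⋆, then w' belongs to Ω(Γ₀), and moreover there exists an index i such that the ⋆-decomposition of w' is (v₁,…,v_{i−1}, u_i, u_{i+1}, v_{i+2},…,v_k) and the 2⋆-operation transforms w into w' by replacing the factor v_i v_{i+1} of w by the word u_i u_{i+1}. -/

import Mathlib

namespace ArtinTits

open Classical List

variable {S : Type*}

/-- A word over `S ∪ S⁻¹`: a list of letters, each a generator together with a sign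
(`true` = the generator itself, `false` = its formal inverse). -/
abbrev Word (S : Type*) := List (S × Bool)

/-- The formal inverse of a word. -/
def wordInv (w : Word S) : Word S := w.reverse.map fun l => (l.1, !l.2)

/-- `[x,y,j⟩`: the alternating positive word `xyxy⋯` with `j` letters, beginning with `x`. -/
def altWord (x y : S) : ℕ → Word S
  | 0 => []
  | j + 1 => (x, true) :: altWord y x j

/-- `⟨x,y,j]`: the alternating positive word `⋯xy` with `j` letters, ending with `y`. -/
def altWordR (x y : S) (j : ℕ) : Word S := (altWord y x j).reverse

/-- The data of a labelled finite complete simplicial graph `Γ₀`: a symmetric label map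
with values in `{2,3,…} ∪ {∞}` on pairs of distinct vertices. -/
structure ArtinData (S : Type*) where
  m : S → S → ℕ∞
  symm : ∀ s t, m s t = m t s
  two_le : ∀ s t : S, s ≠ t → 2 ≤ m s t

/-- `u = v` is a defining (braid) relation of the Artin–Tits presentation. -/
def IsRel (A : ArtinData S) (u v : Word S) : Prop :=
  ∃ (s t : S) (k : ℕ), s ≠ t ∧ A.m s t = (k : ℕ∞) ∧
    u = altWord s t k ∧ v = altWord t s k

/-- The relator set of the Artin–Tits presentation, inside the free group. -/
def rels (A : ArtinData S) : Set (FreeGroup S) :=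
  {x | ∃ u v : Word S, IsRel A u v ∧ x = FreeGroup.mk u * (FreeGroup.mk v)⁻¹}

/-- The Artin–Tits group `A(Γ₀)` of the presentation. -/
abbrev ArtinGroup (A : ArtinData S) := PresentedGroup (rels A)

/-- `w̄`: the element of the Artin–Tits group represented by the word `w`. -/
def wbar (A : ArtinData S) (w : Word S) : ArtinGroup A :=
  PresentedGroup.mk (rels A) (FreeGroup.mk w)

/-! ### Special transformations -/

/-- Type 0: delete a factor `s s⁻¹` or `s⁻¹ s`. -/
def Step0 (w w' : Word S) : Prop :=
  ∃ (w₁ w₂ : Word S) (s : S) (b : Bool),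
    w = w₁ ++ [(s, b), (s, !b)] ++ w₂ ∧ w' = w₁ ++ w₂

/-- Type ∞: insert a factor `s s⁻¹` or `s⁻¹ s` (the inverse of type 0). -/
def StepInfty (w w' : Word S) : Prop := Step0 w' w

/-- Type 1: replace a factor `v` by `u`, or `v⁻¹` by `u⁻¹`, where `u = v` is a defining
relation. -/
def Step1 (A : ArtinData S) (w w' : Word S) : Prop :=
  ∃ (w₁ w₂ u v : Word S), IsRel A u v ∧
    ((w = w₁ ++ v ++ w₂ ∧ w' = w₁ ++ u ++ w₂) ∨
     (w = w₁ ++ wordInv v ++ w₂ ∧ w' = w₁ ++ wordInv u ++ w₂))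

/-- Type 2r: for a defining relation `u₁u₂ = v₁v₂` with `u₁, v₁` non-empty, replace a factor
`v₁⁻¹ u₁` by `v₂ u₂⁻¹`. -/
def Step2r (A : ArtinData S) (w w' : Word S) : Prop :=
  ∃ (w₁ w₂ u₁ u₂ v₁ v₂ : Word S), IsRel A (u₁ ++ u₂) (v₁ ++ v₂) ∧
    u₁ ≠ [] ∧ v₁ ≠ [] ∧
    w = w₁ ++ wordInv v₁ ++ u₁ ++ w₂ ∧ w' = w₁ ++ v₂ ++ wordInv u₂ ++ w₂

/-- Type 2l: for a defining relation `u₁u₂ = v₁v₂` with `u₂, v₂` non-empty, replace a factor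
`v₂ u₂⁻¹` by `v₁⁻¹ u₁`. -/
def Step2l (A : ArtinData S) (w w' : Word S) : Prop :=
  ∃ (w₁ w₂ u₁ u₂ v₁ v₂ : Word S), IsRel A (u₁ ++ u₂) (v₁ ++ v₂) ∧
    u₂ ≠ [] ∧ v₂ ≠ [] ∧
    w = w₁ ++ v₂ ++ wordInv u₂ ++ w₂ ∧ w' = w₁ ++ wordInv v₁ ++ u₁ ++ w₂

/-- Type 2: a type 2r or type 2l transformation. -/
def Step2 (A : ArtinData S) (w w' : Word S) : Prop := Step2r A w w' ∨ Step2l A w w'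

/-- `p` is the greatest (longest) common left factor of `x` and `y`. -/
def IsLCPrefix (p x y : Word S) : Prop :=
  p <+: x ∧ p <+: y ∧ ∀ q : Word S, q <+: x → q <+: y → q.length ≤ p.length

/-- `p` is the greatest (longest) common right factor of `x` and `y`. -/
def IsLCSuffix (p x y : Word S) : Prop :=
  p <:+ x ∧ p <:+ y ∧ ∀ q : Word S, q <:+ x → q <:+ y → q.length ≤ p.length

/-- Type 2r⋆ : a type 2r transformation `w₁ v⁻¹ v' w₂ → w₁ u (u')⁻¹ w₂` (with `vu = v'u'` a
defining relation) such that `v` is the greatest common left factor of `vu` and `v w₁⁻¹`, and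
`v'` is the greatest common left factor of `v'u'` and `v' w₂`. -/
def Step2rStar (A : ArtinData S) (w w' : Word S) : Prop :=
  ∃ (w₁ w₂ v u v' u' : Word S), IsRel A (v ++ u) (v' ++ u') ∧
    v ≠ [] ∧ v' ≠ [] ∧
    w = w₁ ++ wordInv v ++ v' ++ w₂ ∧
    w' = w₁ ++ u ++ wordInv u' ++ w₂ ∧
    IsLCPrefix v (v ++ u) (v ++ wordInv w₁) ∧
    IsLCPrefix v' (v' ++ u') (v' ++ w₂)

/-- Type 2l⋆ : a type 2l transformation `w₁ v (v')⁻¹ w₂ → w₁ u⁻¹ u' w₂` (with `uv = u'v'` a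
defining relation) such that `v` is the greatest common right factor of `uv` and `w₁ v`, and
`v'` is the greatest common right factor of `u'v'` and `w₂⁻¹ v'`. -/
def Step2lStar (A : ArtinData S) (w w' : Word S) : Prop :=
  ∃ (w₁ w₂ v u v' u' : Word S), IsRel A (u ++ v) (u' ++ v') ∧
    v ≠ [] ∧ v' ≠ [] ∧
    w = w₁ ++ v ++ wordInv v' ++ w₂ ∧
    w' = w₁ ++ wordInv u ++ u' ++ w₂ ∧
    IsLCSuffix v (u ++ v) (w₁ ++ v) ∧
    IsLCSuffix v' (u' ++ v') (wordInv w₂ ++ v')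

/-- Type 2⋆ : a type 2r⋆ or type 2l⋆ transformation. -/
def Step2Star (A : ArtinData S) (w w' : Word S) : Prop :=
  Step2rStar A w w' ∨ Step2lStar A w w'

/-- `w →_{0,1,2} w'`. -/
def Steps012 (A : ArtinData S) : Word S → Word S → Prop :=
  Relation.ReflTransGen fun x y => Step0 x y ∨ Step1 A x y ∨ Step2 A x y

/-- `w →_{0,1,2⋆} w'`. -/
def Steps012Star (A : ArtinData S) : Word S → Word S → Prop :=
  Relation.ReflTransGen fun x y => Step0 x y ∨ Step1 A x y ∨ Step2Star A x y

/-- `w →_{2⋆} w'`. -/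
def Steps2Star (A : ArtinData S) : Word S → Word S → Prop :=
  Relation.ReflTransGen (Step2Star A)

/-- `w →_{1,2⋆} w'`. -/
def Steps12Star (A : ArtinData S) : Word S → Word S → Prop :=
  Relation.ReflTransGen fun x y => Step1 A x y ∨ Step2Star A x y

/-- `w →_{1,2} w'`. -/
def Steps12 (A : ArtinData S) : Word S → Word S → Prop :=
  Relation.ReflTransGen fun x y => Step1 A x y ∨ Step2 A x y

/-! ### Classes of words -/

/-- A positive word: written over `S`. -/
def Positive (w : Word S) : Prop := ∀ l ∈ w, l.2 = true

/-- A negative word: written over `S⁻¹`. -/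
def Negative (w : Word S) : Prop := ∀ l ∈ w, l.2 = false

/-- A signed word: positive or negative. -/
def Signed (w : Word S) : Prop := Positive w ∨ Negative w

/-- An unsigned word: neither positive nor negative. -/
def Unsigned (w : Word S) : Prop := ¬ Positive w ∧ ¬ Negative w

/-- A freely reduced word: no factor `s s⁻¹` or `s⁻¹ s`. -/
def FreelyReduced (w : Word S) : Prop :=
  ∀ (w₁ w₂ : Word S) (s : S) (b : Bool), w ≠ w₁ ++ [(s, b), (s, !b)] ++ w₂

/-- A square-free word: no factor `aa`. -/
def SquareFree (w : Word S) : Prop := ∀ a : S × Bool, ¬ [a, a] <:+: w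

/-- `p̃(w)`: the length of the longest square-free positive factor of `w`. -/
noncomputable def ptilde (w : Word S) : ℕ :=
  sSup {n | ∃ v : Word S, v <:+: w ∧ Positive v ∧ SquareFree v ∧ v.length = n}

/-- `ñ(w)`: the length of the longest negative factor of `w` whose formal inverse is
square-free. -/
noncomputable def ntilde (w : Word S) : ℕ :=
  sSup {n | ∃ v : Word S, v <:+: w ∧ Negative v ∧ SquareFree (wordInv v) ∧ v.length = n}

/-- `p(w) = min(p̃(w), m)`. -/
noncomputable def pfun (M : ℕ) (w : Word S) : ℕ := min (ptilde w) M

/-- `n(w) = min(ñ(w), m)`. -/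
noncomputable def nfun (M : ℕ) (w : Word S) : ℕ := min (ntilde w) M

/-- `Ω(Γ₀)` (for a dihedral presentation with label `M`): the freely reduced words with
`max(p(w), n(w)) < M`. -/
def Omega (M : ℕ) (w : Word S) : Prop :=
  FreelyReduced w ∧ max (pfun M w) (nfun M w) < M

/-- A signed square-free word (square-free positive, or negative with square-free inverse). -/
def SignedSF (w : Word S) : Prop :=
  (Positive w ∧ SquareFree w) ∨ (Negative w ∧ SquareFree (wordInv w))

/-- `v` is the maximal square-free signed left factor of `w`. -/
def MaxSignedSFPrefix (v w : Word S) : Prop :=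
  v <+: w ∧ SignedSF v ∧ ∀ v' : Word S, v' <+: w → SignedSF v' → v'.length ≤ v.length

/-- `(v₁, …, v_k)` is the `⋆`-decomposition of `w`: the `v_i` are non-empty, `w = v₁⋯v_k`,
and each `v_i` is the maximal square-free signed left factor of `v_i⋯v_k`. -/
def StarDecomp (w : Word S) (L : List (Word S)) : Prop :=
  w = L.flatten ∧ (∀ v ∈ L, v ≠ ([] : Word S)) ∧
    ∀ i (h : i < L.length), MaxSignedSFPrefix (L.get ⟨i, h⟩) ((L.drop i).flatten)

/-! ### Groups, parabolic subgroups, geodesics -/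

/-- A word written over `T ∪ T⁻¹` for a subset `T` of the generators. -/
def WordOver (T : Set S) (w : Word S) : Prop := ∀ l ∈ w, l.1 ∈ T

/-- The standard parabolic subgroup `A_T` generated by the image of `T ⊆ S`. -/
def parab (A : ArtinData S) (T : Set S) : Subgroup (ArtinGroup A) :=
  Subgroup.closure {x | ∃ s ∈ T, x = wbar A [(s, true)]}

/-- A geodesic word: of minimal length among all words representing the same element. -/
def Geodesic (A : ArtinData S) (w : Word S) : Prop :=
  ∀ w' : Word S, wbar A w' = wbar A w → w.length ≤ w'.length

/-- A word over `T ∪ T⁻¹` that is geodesic among the words over `T ∪ T⁻¹` representing the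
same element. -/
def GeodesicOver (A : ArtinData S) (T : Set S) (w : Word S) : Prop :=
  WordOver T w ∧
    ∀ w' : Word S, WordOver T w' → wbar A w' = wbar A w → w.length ≤ w'.length

/-- The length of a group element: the length of any geodesic representative word. -/
noncomputable def elLength (A : ArtinData S) (g : ArtinGroup A) : ℕ :=
  sInf {n | ∃ w : Word S, wbar A w = g ∧ w.length = n}

/-- A positive element: one represented by a positive word. -/
def IsPosElt (A : ArtinData S) (g : ArtinGroup A) : Prop :=
  ∃ w : Word S, Positive w ∧ wbar A w = g

/-- An `H`-transversal: a subset containing `1` and exactly one element of each left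
`H`-coset. -/
def IsLeftTransversal {G : Type*} [Group G] (H : Subgroup G) (T : Set G) : Prop :=
  (1 : G) ∈ T ∧ ∀ g : G, ∃! x, x ∈ T ∧ g⁻¹ * x ∈ H

/-! ### Properties H, H⁺, H# -/

/-- Property `H`: `w →_{0,1,2} ε ↔ w̄ = 1`. -/
def PropertyH (A : ArtinData S) : Prop :=
  ∀ w : Word S, Steps012 A w [] ↔ wbar A w = 1

/-- Property `H⁺`: every word representing an element of a standard parabolic subgroup
`A_{S₀}` can be transformed by `→_{0,1,2⋆}` into a word over `S₀ ∪ S₀⁻¹`. -/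
def PropertyHPlus (A : ArtinData S) : Prop :=
  ∀ (S₀ : Set S) (w : Word S), wbar A w ∈ parab A S₀ →
    ∃ w₀ : Word S, WordOver S₀ w₀ ∧ Steps012Star A w w₀

/-- Property `H#` with respect to an `S`-sequence of transversals `T`. -/
def PropertyHSharpWrt (A : ArtinData S) (T : Set S → Set (ArtinGroup A)) : Prop :=
  (∀ S₀ : Set S, IsLeftTransversal (parab A S₀) (T S₀)) ∧
    ∀ (S' S₀ : Set S) (w : Word S), wbar A w ∈ parab A S' →
      ∃ v u : Word S, WordOver S' v ∧ WordOver (S' ∩ S₀) u ∧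
        Steps012 A w (v ++ u) ∧ wbar A v ∈ T S₀

/-- Property `H#`: property `H#` with respect to some `S`-sequence of transversals. -/
def PropertyHSharp (A : ArtinData S) : Prop :=
  ∃ T : Set S → Set (ArtinGroup A), PropertyHSharpWrt A T

/-! ### Critical words and the involution τ (relative to a dihedral pair) -/

/-- The permutation `δ` induced by conjugation by `Δ`, extended letterwise to words:
the identity if `M` is even, and the swap of `s` and `t` if `M` is odd. -/
noncomputable def deltaMap (s t : S) (M : ℕ) (w : Word S) : Word S :=
  if Even M then w
  else w.map fun l => (if l.1 = s then t else if l.1 = t then s else l.1, l.2)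

/-- `w` is an unsigned critical word (of the dihedral pair `{s,t}` with label `M`) and
`w' = τ(w)`. -/
def UCritTauPair (A : ArtinData S) (s t : S) (M : ℕ) (w w' : Word S) : Prop :=
  WordOver {s, t} w ∧ FreelyReduced w ∧ Unsigned w ∧ GeodesicOver A {s, t} w ∧
  pfun M w + nfun M w = M ∧
  ∃ (x y z z' : S) (wm : Word S),
    ({x, y} : Set S) = {s, t} ∧ ({z, z'} : Set S) = {s, t} ∧
    ((w = altWord x y (pfun M w) ++ wm ++ wordInv (altWord z z' (nfun M w)) ∧
      w' = wordInv (altWordR x y (nfun M w)) ++ deltaMap s t M wm ++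
        altWordR z z' (pfun M w)) ∨
     (w = wordInv (altWordR x y (nfun M w)) ++ wm ++ altWordR z z' (pfun M w) ∧
      w' = altWord x y (pfun M w) ++ deltaMap s t M wm ++
        wordInv (altWord z z' (nfun M w))))

/-- `w` is a positive critical word (of the dihedral pair `{s,t}` with label `M`) and
`w' = τ(w)`. -/
def PosCritTauPair (A : ArtinData S) (s t : S) (M : ℕ) (w w' : Word S) : Prop :=
  WordOver {s, t} w ∧ Positive w ∧ pfun M w = M ∧
  ∃ (x y : S) (wm : Word S), ({x, y} : Set S) = {s, t} ∧ pfun M wm < M ∧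
    ((w = altWord x y M ++ wm ∧
      (w' = deltaMap s t M wm ++ altWordR x y M ∨
       w' = deltaMap s t M wm ++ altWordR y x M) ∧
      w'.getLast? ≠ w.getLast?) ∨
     (w = wm ++ altWordR x y M ∧
      (w' = altWord x y M ++ deltaMap s t M wm ∨
       w' = altWord y x M ++ deltaMap s t M wm) ∧
      w'.head? ≠ w.head?))

/-- `w` is a negative critical word and `w' = τ(w)` (defined via formal inverses). -/
def NegCritTauPair (A : ArtinData S) (s t : S) (M : ℕ) (w w' : Word S) : Prop :=
  PosCritTauPair A s t M (wordInv w) (wordInv w')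

/-- `w` is a critical word (unsigned, positive or negative) and `w' = τ(w)`. -/
def CritTauPair (A : ArtinData S) (s t : S) (M : ℕ) (w w' : Word S) : Prop :=
  UCritTauPair A s t M w w' ∨ PosCritTauPair A s t M w w' ∨ NegCritTauPair A s t M w w'

/-- A type β transformation relative to the dihedral pair `{s,t}` with label `M`:
replace a critical factor `v` by `τ(v)`. -/
def StepBetaPair (A : ArtinData S) (s t : S) (M : ℕ) (w w' : Word S) : Prop :=
  ∃ (w₁ w₂ v v' : Word S), w = w₁ ++ v ++ w₂ ∧ w' = w₁ ++ v' ++ w₂ ∧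
    CritTauPair A s t M v v'

/-- A type β transformation (in an Artin–Tits group): a type β transformation relative to some
dihedral standard parabolic subgroup (a pair of generators with finite label). -/
def StepBeta (A : ArtinData S) (w w' : Word S) : Prop :=
  ∃ (s t : S) (M : ℕ), s ≠ t ∧ A.m s t = (M : ℕ∞) ∧ StepBetaPair A s t M w w'

/-! ### Restriction, direct products, Coxeter graph notions -/

/-- The Artin–Tits presentation induced on a subset `T` of the generators (the presentation of
the standard parabolic subgroup `A_T`). -/
def ArtinData.restrict (A : ArtinData S) (T : Set S) : ArtinData T where
  m a b := A.m a b
  symm a b := A.symm a b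
  two_le a b h := A.two_le a b fun h' => h (Subtype.ext h')

/-- The Artin–Tits presentation on the disjoint union `S₁ ⊕ S₂` obtained from presentations on
`S₁` and `S₂` by adding the commuting relations `s₁s₂ = s₂s₁` (label `2`) for `s₁ ∈ S₁`,
`s₂ ∈ S₂`. -/
def prodData {S₁ S₂ : Type*} (A₁ : ArtinData S₁) (A₂ : ArtinData S₂) :
    ArtinData (S₁ ⊕ S₂) where
  m x y :=
    match x, y with
    | Sum.inl a, Sum.inl b => A₁.m a b
    | Sum.inr a, Sum.inr b => A₂.m a b
    | _, _ => 2
  symm x y := by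
    cases x <;> cases y
    · exact A₁.symm _ _
    · rfl
    · rfl
    · exact A₂.symm _ _
  two_le x y h := by
    cases x <;> cases y
    · exact A₁.two_le _ _ fun h' => h (congrArg Sum.inl h')
    · exact le_rfl
    · exact le_rfl
    · exact A₂.two_le _ _ fun h' => h (congrArg Sum.inr h')

/-- Adjacency in the Coxeter graph `Γ` restricted to `T`: distinct vertices of `T` joined by an
edge (i.e. with label `≠ 2`, edges labelled `2` being removed in `Γ`). -/
def coxAdj (A : ArtinData S) (T : Set S) (x y : S) : Prop :=
  x ∈ T ∧ y ∈ T ∧ x ≠ y ∧ A.m x y ≠ 2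

/-- The full subgraph of the Coxeter graph on the vertex subset `T` is connected. -/
def CoxConnected (A : ArtinData S) (T : Set S) : Prop :=
  ∀ x ∈ T, ∀ y ∈ T, Relation.ReflTransGen (coxAdj A T) x y

/-- The relator set of the Coxeter presentation on `T`: the Artin relations together with the
squares of the generators. -/
def coxRels (A : ArtinData S) (T : Set S) : Set (FreeGroup T) :=
  rels (A.restrict T) ∪ {g | ∃ x : T, g = FreeGroup.of x * FreeGroup.of x}

/-- The induced presentation on `T` is of spherical type: its Coxeter group is finite. -/
def SphericalType (A : ArtinData S) (T : Set S) : Prop :=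
  Finite (PresentedGroup (coxRels A T))

/-- The induced presentation on `T` is of large type: all labels are `≥ 3` (possibly `∞`). -/
def LargeTypeOn (A : ArtinData S) (T : Set S) : Prop :=
  ∀ x ∈ T, ∀ y ∈ T, x ≠ y → 3 ≤ A.m x y

/-! ### Blocks of signed square-free words -/

/-- Two letters that may follow each other in a signed square-free word: same sign, different
generators. -/
def Alternates (p q : S × Bool) : Prop := p.2 = q.2 ∧ p.1 ≠ q.1

/-- Two mutually inverse letters. -/
def Cancels (p q : S × Bool) : Prop := p.1 = q.1 ∧ p.2 ≠ q.2

theorem freelyReduced_iff_isChain (w : Word S) :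
    FreelyReduced w ↔ w.IsChain fun p q => ¬ Cancels p q := by
  rw [List.isChain_iff_forall_rel_of_append_cons_cons]
  constructor
  · rintro h ⟨a, b⟩ ⟨c, d⟩ l₁ l₂ rfl ⟨h₁, h₂⟩
    dsimp only at h₁ h₂
    subst h₁
    refine h l₁ l₂ a b ?_
    have : d = !b := by cases b <;> cases d <;> simp_all
    simp [this]
  · rintro h w₁ w₂ x b rfl
    exact h (a := (x, b)) (b := (x, !b)) (l₁ := w₁) (l₂ := w₂) (by simp)
      ⟨rfl, by cases b <;> simp⟩

theorem wordInv_nil : wordInv ([] : Word S) = [] := rfl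

theorem wordInv_append (u v : Word S) : wordInv (u ++ v) = wordInv v ++ wordInv u := by
  simp [wordInv]

theorem wordInv_cons (a : S × Bool) (v : Word S) :
    wordInv (a :: v) = wordInv v ++ [(a.1, !a.2)] := by
  simp [wordInv]

theorem wordInv_wordInv (w : Word S) : wordInv (wordInv w) = w := by
  induction w with
  | nil => rfl
  | cons a w ih => simp [wordInv_cons, wordInv_append, wordInv_nil, ih]

theorem length_wordInv (w : Word S) : (wordInv w).length = w.length := by
  simp [wordInv]

theorem isChain_wordInv {w : Word S} (h : w.IsChain Alternates) :
    (wordInv w).IsChain Alternates := by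
  unfold wordInv
  rw [List.isChain_map, List.isChain_reverse]
  exact h.imp fun a b hab => ⟨by simp [hab.1], hab.2.symm⟩

theorem SquareFree.wordInv {w : Word S} (h : SquareFree w) : SquareFree (wordInv w) := by
  rintro a ⟨x, y, hxy⟩
  refine h (a.1, !a.2) ⟨ArtinTits.wordInv y, ArtinTits.wordInv x, ?_⟩
  rw [← wordInv_wordInv w, ← hxy]
  simp [wordInv_append, wordInv_cons]

theorem snd_eq_of_isChain {a : S × Bool} {w : Word S} (h : (a :: w).IsChain Alternates) :
    ∀ l ∈ a :: w, l.2 = a.2 := by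
  induction w generalizing a with
  | nil => simp
  | cons b w ih =>
    rw [List.isChain_cons_cons] at h
    intro l hl
    rcases List.mem_cons.1 hl with rfl | hl
    · rfl
    · rw [ih h.2 l hl, h.1.1]

theorem squareFree_of_isChain {w : Word S} (h : w.IsChain Alternates) : SquareFree w := by
  intro a ha
  have := h.infix ha
  simp [Alternates] at this

theorem isChain_of_squareFree {w : Word S} {b : Bool} (hb : ∀ l ∈ w, l.2 = b)
    (h : SquareFree w) : w.IsChain Alternates := by
  rw [List.isChain_iff_forall_rel_of_append_cons_cons]
  rintro p q l₁ l₂ rfl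
  have hp := hb p (by simp)
  have hq := hb q (by simp)
  refine ⟨hp.trans hq.symm, fun hpq => h p ⟨l₁, l₂, ?_⟩⟩
  have : p = q := Prod.ext hpq (hp.trans hq.symm)
  simp [this]

theorem signedSF_iff_isChain (w : Word S) : SignedSF w ↔ w.IsChain Alternates := by
  constructor
  · rintro (⟨h₁, h₂⟩ | ⟨h₁, h₂⟩)
    · exact isChain_of_squareFree h₁ h₂
    · exact isChain_of_squareFree h₁ (by simpa [wordInv_wordInv] using h₂.wordInv)
  · intro h
    have hs := squareFree_of_isChain h
    cases w with
    | nil => exact Or.inl ⟨by simp [Positive], hs⟩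
    | cons a w =>
      have ha := snd_eq_of_isChain h
      cases hb : a.2 with
      | true => exact Or.inl ⟨fun l hl => (ha l hl).trans hb, hs⟩
      | false => exact Or.inr ⟨fun l hl => (ha l hl).trans hb, hs.wordInv⟩

theorem sSup_length_infix_lt_iff {M : ℕ} (w : Word S) {P : Word S → Prop}
    (hP : P []) :
    sSup {n | ∃ v : Word S, v <:+: w ∧ P v ∧ v.length = n} < M ↔
      ∀ v : Word S, v <:+: w → P v → v.length < M := by
  have hbdd : BddAbove {n | ∃ v : Word S, v <:+: w ∧ P v ∧ v.length = n} := by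
    refine ⟨w.length, ?_⟩
    rintro n ⟨v, hv, -, rfl⟩
    exact hv.length_le
  constructor
  · exact fun h v hv hPv => (le_csSup hbdd ⟨v, hv, hPv, rfl⟩).trans_lt h
  · intro h
    obtain ⟨v, hv, hPv, hn⟩ :=
      Nat.sSup_mem (s := {n | ∃ v : Word S, v <:+: w ∧ P v ∧ v.length = n})
        ⟨0, [], List.nil_infix, hP, rfl⟩ hbdd
    exact hn ▸ h v hv hPv

theorem omega_iff {M : ℕ} (w : Word S) :
    Omega M w ↔ (w.IsChain fun p q => ¬ Cancels p q) ∧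
      ∀ v : Word S, v <:+: w → v.IsChain Alternates → v.length < M := by
  have hp : ptilde w < M ↔
      ∀ v : Word S, v <:+: w → Positive v ∧ SquareFree v → v.length < M := by
    rw [← sSup_length_infix_lt_iff w (P := fun v => Positive v ∧ SquareFree v)
      ⟨by simp [Positive], by simp [SquareFree]⟩]
    simp only [ptilde, and_assoc]
  have hn : ntilde w < M ↔
      ∀ v : Word S, v <:+: w → Negative v ∧ SquareFree (wordInv v) → v.length < M := by
    rw [← sSup_length_infix_lt_iff w (P := fun v => Negative v ∧ SquareFree (wordInv v))
      ⟨by simp [Negative], by simp [SquareFree, wordInv]⟩]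
    simp only [ntilde, and_assoc]
  simp only [Omega, freelyReduced_iff_isChain, pfun, nfun, max_lt_iff, min_lt_iff, lt_irrefl,
    or_false, hp, hn, ← signedSF_iff_isChain, SignedSF]
  refine and_congr_right fun _ => ⟨fun h v hv => ?_, fun h => ⟨?_, ?_⟩⟩
  · rintro (hv' | hv')
    exacts [h.1 v hv hv', h.2 v hv hv']
  · exact fun v hv hv' => h v hv (Or.inl hv')
  · exact fun v hv hv' => h v hv (Or.inr hv')

theorem infix_of_isChain_of_append {v x y : Word S} (hv : v.IsChain Alternates)
    (hxy : ∀ a ∈ x.getLast?, ∀ b ∈ y.head?, ¬ Alternates a b) (h : v <:+: x ++ y) :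
    v <:+: x ∨ v <:+: y := by
  rcases List.infix_append_iff_ne_nil.1 h with h | h | ⟨l₁, l₂, h₁, h₂, rfl, ⟨x', rfl⟩, y', rfl⟩
  · exact Or.inl h
  · exact Or.inr h
  · obtain ⟨l₁, a, rfl⟩ := List.eq_nil_or_concat' l₁ |>.resolve_left h₁
    obtain ⟨b, l₂, rfl⟩ := List.exists_cons_of_ne_nil h₂
    refine absurd ?_ (hxy a (by simp) b (by simp))
    exact (List.isChain_append.1 hv).2.2 a (by simp) b (by simp)

theorem maxSignedSFPrefix_append_iff {a r : Word S} (ha : a ≠ []) :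
    MaxSignedSFPrefix a (a ++ r) ↔ a.IsChain Alternates ∧
      ∀ x ∈ a.getLast?, ∀ y ∈ r.head?, ¬ Alternates x y := by
  simp only [MaxSignedSFPrefix, signedSF_iff_isChain]
  constructor
  · rintro ⟨-, h, hmax⟩
    refine ⟨h, fun x hx y hy hxy => ?_⟩
    cases r with
    | nil => simp at hy
    | cons z r =>
      obtain rfl : z = y := by simpa using hy
      have := hmax (a ++ [z]) (by simp) (List.isChain_append.2
        ⟨h, by simp, fun x' hx' y' hy' => ?_⟩)
      · simp at this
      · obtain rfl : z = y' := by simpa using hy'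
        rwa [Option.mem_unique hx' hx]
  · rintro ⟨h, hmax⟩
    refine ⟨List.prefix_append _ _, h, fun v hv hc => ?_⟩
    by_contra! hlt
    obtain ⟨u, rfl⟩ := List.prefix_of_prefix_length_le (List.prefix_append a r) hv hlt.le
    cases u with
    | nil => simp at hlt
    | cons z u =>
      obtain ⟨u', rfl⟩ := (List.prefix_append_right_inj a).1 hv
      refine hmax (a.getLast ha) (List.getLast_mem_getLast? ha) z (by simp) ?_
      exact (List.isChain_append.1 hc).2.2 _ (List.getLast_mem_getLast? ha) z (by simp)

/-- The Boolean version of `Alternates`. -/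
noncomputable def alternatesB (p q : S × Bool) : Bool := decide (Alternates p q)

theorem starDecomp_cons_iff (w a : Word S) (L : List (Word S)) :
    StarDecomp w (a :: L) ↔ w = a ++ L.flatten ∧ a ≠ [] ∧
      MaxSignedSFPrefix a (a ++ L.flatten) ∧ StarDecomp L.flatten L := by
  simp only [StarDecomp, List.flatten_cons, List.forall_mem_cons, true_and]
  constructor
  · rintro ⟨hw, ⟨ha, hne⟩, hmax⟩
    exact ⟨hw, ha, hmax 0 (by simp), hne, fun i hi => hmax (i + 1) (by simpa using hi)⟩
  · rintro ⟨hw, ha, h, hne, hmax⟩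
    refine ⟨hw, ⟨ha, hne⟩, ?_⟩
    rintro (_ | i) hi
    · exact h
    · exact hmax i (by simpa using hi)

theorem starDecomp_iff (w : Word S) (L : List (Word S)) :
    StarDecomp w L ↔ w.splitBy alternatesB = L := by
  rw [List.splitBy_eq_iff]
  simp only [alternatesB, decide_eq_true_eq, decide_eq_false_iff_not]
  induction L generalizing w with
  | nil => simp [StarDecomp]
  | cons a L ih =>
    rw [starDecomp_cons_iff, ih, List.isChain_cons]
    by_cases ha : a = []
    · simp [ha]
    rw [maxSignedSFPrefix_append_iff ha]
    cases L with
    | nil => simp [ha, eq_comm]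
    | cons b L =>
      by_cases hb : b = []
      · simp [hb]
      have hh : (b ++ L.flatten).head? = some (b.head hb) := by
        simp [List.head?_append, List.head?_eq_some_head hb]
      simp [ha, hb, hh, List.getLast?_eq_some_getLast ha, Ne.symm ha, Ne.symm hb]
      tauto

/-- A condition on a block boundary: the neighbouring letter is `l`, and the letter next to it is
changed from `a` to `b`. -/
def GoodSwap (l a b : S × Bool) : Prop :=
  a.1 ≠ b.1 ∧ a.2 ≠ b.2 ∧ l ≠ (b.1, !b.2)

theorem GoodSwap.not_alternates {s t : S} (hd : ∀ x : S, x = s ∨ x = t) {l a b : S × Bool}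
    (h : GoodSwap l a b) (hc : ¬ Cancels l a) :
    ¬ Alternates l a ∧ ¬ Alternates l b ∧ ¬ Cancels l b := by
  obtain ⟨l, i⟩ := l
  obtain ⟨a, j⟩ := a
  obtain ⟨b, k⟩ := b
  simp only [GoodSwap, Alternates, Cancels, not_and] at *
  have hl := hd l
  have ha := hd a
  have hb := hd b
  cases i <;> cases j <;> cases k <;> simp at * <;> grind

theorem Alternates.symm {a b : S × Bool} (h : Alternates a b) : Alternates b a :=
  ⟨h.1.symm, h.2.symm⟩

theorem Cancels.symm {a b : S × Bool} (h : Cancels a b) : Cancels b a :=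
  ⟨h.1.symm, h.2.symm⟩

theorem splitBy_replace {w₁ w₂ p q : Word S} (hp : p ≠ []) (hq : q ≠ [])
    (hpc : p.IsChain Alternates) (hqc : q.IsChain Alternates)
    (h₁ : ∀ a ∈ w₁.getLast?, ∀ b ∈ p.head?, ¬ Alternates a b)
    (h₂ : ∀ a ∈ p.getLast?, ∀ b ∈ q.head?, ¬ Alternates a b)
    (h₃ : ∀ a ∈ q.getLast?, ∀ b ∈ w₂.head?, ¬ Alternates a b) :
    (w₁ ++ (p ++ (q ++ w₂))).splitBy alternatesB =
      w₁.splitBy alternatesB ++ (p :: q :: w₂.splitBy alternatesB) := by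
  have hpq : (p ++ (q ++ w₂)).head? = p.head? := by
    rw [List.head?_append_of_ne_nil _ hp]
  have hqw : (q ++ w₂).head? = q.head? := by
    rw [List.head?_append_of_ne_nil _ hq]
  rw [List.splitBy_append, List.splitBy_append, List.splitBy_append,
    List.splitBy_of_isChain hp, List.splitBy_of_isChain hq]
  · simp
  · simpa [alternatesB] using hqc
  · simpa [alternatesB] using hpc
  · simpa [alternatesB] using h₃
  · simpa only [alternatesB, hqw, decide_eq_false_iff_not] using h₂
  · simpa only [alternatesB, hpq, decide_eq_false_iff_not] using h₁

/-- Replacing two consecutive blocks of a word by two signed square-free words of opposite signs,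
with a change of both sign and generator at the outer ends. -/
theorem omega_and_starDecomp_of_replace {s t : S} (hd : ∀ x : S, x = s ∨ x = t) {M : ℕ}
    {w₁ w₂ p q p' q' : Word S} {L : List (Word S)}
    (hΩ : Omega M (w₁ ++ p ++ q ++ w₂)) (hL : StarDecomp (w₁ ++ p ++ q ++ w₂) L)
    (hp : p ≠ []) (hq : q ≠ []) (hp' : p' ≠ []) (hq' : q' ≠ [])
    (hpc : p.IsChain Alternates) (hqc : q.IsChain Alternates)
    (hpc' : p'.IsChain Alternates) (hqc' : q'.IsChain Alternates)
    (hpM : p'.length < M) (hqM : q'.length < M)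
    (h₁ : ∀ l ∈ w₁.getLast?, ∀ a ∈ p.head?, ∀ b ∈ p'.head?, GoodSwap l a b)
    (h₂ : ∀ l ∈ w₂.head?, ∀ a ∈ q.getLast?, ∀ b ∈ q'.getLast?, GoodSwap l a b)
    (hpq : ∀ a ∈ p.getLast?, ∀ b ∈ q.head?, a.2 ≠ b.2)
    (hpq' : ∀ a ∈ p'.getLast?, ∀ b ∈ q'.head?, a.1 ≠ b.1 ∧ a.2 ≠ b.2) :
    Omega M (w₁ ++ p' ++ q' ++ w₂) ∧
      ∃ i, i + 1 < L.length ∧ ∃ u₁ u₂ : Word S,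
        w₁ ++ p ++ q ++ w₂ = (L.take i).flatten ++ L.getD i [] ++ L.getD (i+1) [] ++
          (L.drop (i+2)).flatten ∧
        w₁ ++ p' ++ q' ++ w₂ = (L.take i).flatten ++ u₁ ++ u₂ ++ (L.drop (i+2)).flatten ∧
        StarDecomp (w₁ ++ p' ++ q' ++ w₂) (L.take i ++ [u₁, u₂] ++ L.drop (i+2)) := by
  simp only [List.append_assoc] at *
  rw [omega_iff] at *
  rw [starDecomp_iff] at *
  obtain ⟨hfr, hlen⟩ := hΩ
  have hph : (p ++ (q ++ w₂)).head? = p.head? := List.head?_append_of_ne_nil _ hp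
  have hph' : (p' ++ (q' ++ w₂)).head? = p'.head? := List.head?_append_of_ne_nil _ hp'
  have hqh' : (q' ++ w₂).head? = q'.head? := List.head?_append_of_ne_nil _ hq'
  rw [List.isChain_append, hph, List.isChain_append, List.isChain_append] at hfr
  obtain ⟨hfr₁, ⟨-, ⟨-, hfr₂, hqw⟩, -⟩, hwp⟩ := hfr
  have k₁ : ∀ l ∈ w₁.getLast?, ∀ a ∈ p.head?, ∀ b ∈ p'.head?,
      ¬ Alternates l a ∧ ¬ Alternates l b ∧ ¬ Cancels l b := fun l hl a ha b hb =>
    (h₁ l hl a ha b hb).not_alternates hd (hwp l hl a ha)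
  have k₂ : ∀ l ∈ w₂.head?, ∀ a ∈ q.getLast?, ∀ b ∈ q'.getLast?,
      ¬ Alternates l a ∧ ¬ Alternates l b ∧ ¬ Cancels l b := fun l hl a ha b hb =>
    (h₂ l hl a ha b hb).not_alternates hd fun h => hqw a ha l hl h.symm
  have e₁ : ∃ a, a ∈ p.head? := ⟨_, List.head_mem_head? hp⟩
  have e₁' : ∃ a, a ∈ p'.head? := ⟨_, List.head_mem_head? hp'⟩
  have e₂ : ∃ a, a ∈ q.getLast? := ⟨_, List.getLast_mem_getLast? hq⟩
  have e₂' : ∃ a, a ∈ q'.getLast? := ⟨_, List.getLast_mem_getLast? hq'⟩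
  obtain ⟨a₁, ha₁⟩ := e₁
  obtain ⟨b₁, hb₁⟩ := e₁'
  obtain ⟨a₂, ha₂⟩ := e₂
  obtain ⟨b₂, hb₂⟩ := e₂'
  have hold := splitBy_replace (w₁ := w₁) (w₂ := w₂) hp hq hpc hqc
    (fun l hl a ha => (k₁ l hl a ha b₁ hb₁).1) (fun a ha b hb h => hpq a ha b hb h.1)
    (fun a ha l hl h => (k₂ l hl a ha b₂ hb₂).1 h.symm)
  have n₁ : ∀ l ∈ w₁.getLast?, ∀ b ∈ p'.head?, ¬ Alternates l b :=
    fun l hl b hb => (k₁ l hl a₁ ha₁ b hb).2.1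
  have n₂ : ∀ a ∈ p'.getLast?, ∀ b ∈ q'.head?, ¬ Alternates a b :=
    fun a ha b hb h => (hpq' a ha b hb).2 h.1
  have n₃ : ∀ b ∈ q'.getLast?, ∀ l ∈ w₂.head?, ¬ Alternates b l :=
    fun b hb l hl h => (k₂ l hl a₂ ha₂ b hb).2.1 h.symm
  have hnew := splitBy_replace (w₁ := w₁) (w₂ := w₂) hp' hq' hpc' hqc' n₁ n₂ n₃
  have hfree : ∀ {v : Word S}, v.IsChain Alternates → v.IsChain fun p q => ¬ Cancels p q :=
    fun h => h.imp fun a b hab hc => hab.2 hc.1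
  have hdrop : (w₁.splitBy alternatesB ++ (p :: q :: w₂.splitBy alternatesB)).drop
      ((w₁.splitBy alternatesB).length + 2) = w₂.splitBy alternatesB := by
    rw [← List.drop_drop]
    simp
  refine ⟨⟨?_, fun v hv hc => ?_⟩, (w₁.splitBy alternatesB).length, ?_, p', q', ?_, ?_, ?_⟩
  · rw [List.isChain_append, hph', List.isChain_append, hqh', List.isChain_append]
    exact ⟨hfr₁, ⟨hfree hpc', ⟨hfree hqc', hfr₂,
      fun b hb l hl h => (k₂ l hl a₂ ha₂ b hb).2.2 h.symm⟩,
      fun a ha b hb h => (hpq' a ha b hb).1 h.1⟩,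
      fun l hl b hb => (k₁ l hl a₁ ha₁ b hb).2.2⟩
  · rcases infix_of_isChain_of_append hc (by rwa [hph']) hv with h | h
    · exact hlen v (h.trans ⟨[], p ++ (q ++ w₂), by simp⟩) hc
    rcases infix_of_isChain_of_append hc (by rwa [hqh']) h with h | h
    · exact h.length_le.trans_lt hpM
    rcases infix_of_isChain_of_append hc n₃ h with h | h
    · exact h.length_le.trans_lt hqM
    · exact hlen v (h.trans ⟨w₁ ++ (p ++ q), [], by simp⟩) hc
  · rw [← hL, hold]
    simp
  · rw [← hL, hold]
    simp [hdrop, List.flatten_splitBy]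
  · rw [← hL, hold]
    simp [hdrop, List.flatten_splitBy]
  · rw [← hL, hold, starDecomp_iff, hnew]
    simp [hdrop]

/-! ### Alternating words -/

theorem length_altWord (x y : S) (j : ℕ) : (altWord x y j).length = j := by
  induction j generalizing x y with
  | zero => rfl
  | succ j ih => simp [altWord, ih]

theorem positive_altWord (x y : S) (j : ℕ) : Positive (altWord x y j) := by
  induction j generalizing x y with
  | zero => simp [altWord, Positive]
  | succ j ih =>
    intro l hl
    rcases List.mem_cons.1 hl with rfl | hl
    exacts [rfl, ih _ _ l hl]

theorem head?_altWord {x y : S} {j : ℕ} {a : S × Bool} (h : a ∈ (altWord x y j).head?) :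
    a = (x, true) := by
  cases j with
  | zero => simp [altWord] at h
  | succ j => simpa [altWord, eq_comm] using h

theorem isChain_altWord {x y : S} (hxy : x ≠ y) (j : ℕ) :
    (altWord x y j).IsChain Alternates := by
  induction j generalizing x y with
  | zero => simp [altWord]
  | succ j ih =>
    refine List.isChain_cons.2 ⟨fun a ha => ?_, ih hxy.symm⟩
    rw [head?_altWord ha]
    exact ⟨rfl, hxy⟩

theorem getLast?_altWord_ne {x y : S} (hxy : x ≠ y) {j : ℕ} {a b : S × Bool}
    (ha : a ∈ (altWord x y j).getLast?) (hb : b ∈ (altWord y x j).getLast?) : a.1 ≠ b.1 := by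
  induction j generalizing x y with
  | zero => simp [altWord] at ha
  | succ j ih =>
    cases j with
    | zero =>
      simp only [altWord, List.getLast?_singleton, Option.mem_some_iff] at ha hb
      subst ha hb
      exact hxy
    | succ j => exact ih hxy.symm (by simpa [altWord] using ha) (by simpa [altWord] using hb)

theorem IsLCPrefix.ne_of_mem_head? {v u x : Word S} (h : IsLCPrefix v (v ++ u) (v ++ x))
    {a b : S × Bool} (ha : a ∈ u.head?) (hb : b ∈ x.head?) : a ≠ b := by
  rintro rfl
  rw [List.eq_cons_of_mem_head? ha, List.eq_cons_of_mem_head? hb] at h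
  simpa using h.2.2 (v ++ [a]) (by simp) (by simp)

theorem IsLCSuffix.ne_of_mem_getLast? {v u x : Word S} (h : IsLCSuffix v (u ++ v) (x ++ v))
    {a b : S × Bool} (ha : a ∈ u.getLast?) (hb : b ∈ x.getLast?) : a ≠ b := by
  rintro rfl
  have hs : ∀ {y : Word S}, a ∈ y.getLast? → a :: v <:+ y ++ v := by
    intro y hy
    obtain ⟨z, rfl⟩ := List.getLast?_eq_some_iff.1 hy
    exact ⟨z, by simp⟩
  simpa using h.2.2 _ (hs ha) (hs hb)

theorem head?_wordInv (w : Word S) :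
    (wordInv w).head? = w.getLast?.map fun l => (l.1, !l.2) := by
  simp [wordInv]

theorem getLast?_wordInv (w : Word S) :
    (wordInv w).getLast? = w.head?.map fun l => (l.1, !l.2) := by
  simp [wordInv]

theorem wordInv_ne_nil {w : Word S} (h : w ≠ []) : wordInv w ≠ [] := by
  simpa [wordInv] using h

theorem IsRel.exists_altWord {A : ArtinData S} {s t : S} {M : ℕ}
    (hd : ∀ x : S, x = s ∨ x = t) (hM : A.m s t = (M : ℕ∞)) {u v : Word S} (h : IsRel A u v) :
    ∃ x y : S, x ≠ y ∧ u = altWord x y M ∧ v = altWord y x M := by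
  obtain ⟨x, y, k, hxy, hk, rfl, rfl⟩ := h
  have : k = M := by
    rcases hd x with rfl | rfl <;> rcases hd y with rfl | rfl
    · exact absurd rfl hxy
    · exact_mod_cast hk.symm.trans hM
    · exact_mod_cast hk.symm.trans ((A.symm _ _).trans hM)
    · exact absurd rfl hxy
  subst this
  exact ⟨x, y, hxy, rfl, rfl⟩

/-- Proposition 2.6: in a dihedral Artin–Tits group with `m < ∞`, the set
`Ω(Γ₀)` is preserved by type `2⋆` operations, and a `2⋆` operation acts on the
`⋆`-decomposition by replacing two consecutive factors `v_i v_{i+1}` by `u_i u_{i+1}`. -/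
theorem stmt2 {S : Type*} [Finite S] (A : ArtinData S) (s t : S) (M : ℕ)
    (hst : s ≠ t) (hdih : ∀ x : S, x = s ∨ x = t) (hM : A.m s t = (M : ℕ∞))
    (w w' : Word S) (L : List (Word S))
    (hw : w ≠ []) (hΩ : Omega M w) (hL : StarDecomp w L)
    (hstep : Step2Star A w w') :
    Omega M w' ∧
      ∃ i, i + 1 < L.length ∧ ∃ u₁ u₂ : Word S,
        w = (L.take i).flatten ++ L.getD i [] ++ L.getD (i+1) [] ++
          (L.drop (i+2)).flatten ∧
        w' = (L.take i).flatten ++ u₁ ++ u₂ ++ (L.drop (i+2)).flatten ∧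
        StarDecomp w' (L.take i ++ [u₁, u₂] ++ L.drop (i+2)) := by
  have hshort := ((omega_iff w).1 hΩ).2
  rcases hstep with h | h
  · obtain ⟨w₁, w₂, v, u, v', u', hrel, hv, hv', rfl, rfl, hl, hr⟩ := h
    obtain ⟨x, y, hxy, e, e'⟩ := hrel.exists_altWord hdih hM
    have hlen := congrArg List.length e
    have hlen' := congrArg List.length e'
    have hc := isChain_altWord hxy M
    have hc' := isChain_altWord hxy.symm M
    have hpos := positive_altWord x y M
    have hpos' := positive_altWord y x M
    have hlast : ∀ a ∈ u.getLast?, ∀ b ∈ u'.getLast?, a.1 ≠ b.1 := fun a ha b hb =>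
      getLast?_altWord_ne hxy (e ▸ List.mem_getLast?_append_of_mem_getLast? ha)
        (e' ▸ List.mem_getLast?_append_of_mem_getLast? hb)
    rw [← e, List.isChain_append] at hc
    rw [← e', List.isChain_append] at hc'
    rw [← e, Positive, List.forall_mem_append] at hpos
    rw [← e', Positive, List.forall_mem_append] at hpos'
    rw [length_altWord, List.length_append] at hlen hlen'
    have hvM := hshort (wordInv v) ⟨w₁, v' ++ w₂, by simp⟩ (isChain_wordInv hc.1)
    have hvM' := hshort v' ⟨w₁ ++ wordInv v, w₂, by simp⟩ hc'.1
    rw [length_wordInv] at hvM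
    have hvp := List.length_pos_of_ne_nil hv
    have hvp' := List.length_pos_of_ne_nil hv'
    have hu : u ≠ [] := by rintro rfl; simp at hlen; omega
    have hu' : u' ≠ [] := by rintro rfl; simp at hlen'; omega
    refine omega_and_starDecomp_of_replace hdih hΩ hL (wordInv_ne_nil hv) hv' hu
      (wordInv_ne_nil hu') (isChain_wordInv hc.1) hc'.1 hc.2.1 (isChain_wordInv hc'.2.1)
      (by omega) (by rw [length_wordInv]; omega) ?_ ?_ ?_ ?_
    · rw [head?_wordInv]
      intro l hlw a ha b hb
      obtain ⟨a, ha', rfl⟩ := Option.mem_map.1 ha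
      have hab := hc.2.2 a ha' b hb
      refine ⟨hab.2, by simp [hab.1], ?_⟩
      rintro rfl
      exact hl.ne_of_mem_head? hb (by rw [head?_wordInv, hlw]; simp) rfl
    · rw [getLast?_wordInv]
      intro l hlw a ha b hb
      obtain ⟨b, hb', rfl⟩ := Option.mem_map.1 hb
      have hab := hc'.2.2 a ha b hb'
      refine ⟨hab.2, by simp [hab.1], ?_⟩
      rintro rfl
      exact hr.ne_of_mem_head? hb' hlw (by simp)
    · rw [getLast?_wordInv]
      intro a ha b hb
      obtain ⟨a, ha', rfl⟩ := Option.mem_map.1 ha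
      simp [hpos.1 a (List.mem_of_mem_head? ha'), hpos'.1 b (List.mem_of_mem_head? hb)]
    · rw [head?_wordInv]
      intro a ha b hb
      obtain ⟨b, hb', rfl⟩ := Option.mem_map.1 hb
      exact ⟨hlast a ha b hb', by
        simp [hpos.2 a (List.mem_of_mem_getLast? ha), hpos'.2 b (List.mem_of_mem_getLast? hb')]⟩
  · obtain ⟨w₁, w₂, v, u, v', u', hrel, hv, hv', rfl, rfl, hl, hr⟩ := h
    obtain ⟨x, y, hxy, e, e'⟩ := hrel.exists_altWord hdih hM
    have hlen := congrArg List.length e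
    have hlen' := congrArg List.length e'
    have hc := isChain_altWord hxy M
    have hc' := isChain_altWord hxy.symm M
    have hpos := positive_altWord x y M
    have hpos' := positive_altWord y x M
    have hhead : ∀ a ∈ u.head?, ∀ b ∈ u'.head?, a.1 ≠ b.1 := fun a ha b hb => by
      have ha' := List.mem_head?_append_of_mem_head? (t := v) ha
      have hb' := List.mem_head?_append_of_mem_head? (t := v') hb
      rw [e] at ha'
      rw [e'] at hb'
      rw [head?_altWord ha', head?_altWord hb']
      exact hxy
    rw [← e, List.isChain_append] at hc
    rw [← e', List.isChain_append] at hc'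
    rw [← e, Positive, List.forall_mem_append] at hpos
    rw [← e', Positive, List.forall_mem_append] at hpos'
    rw [length_altWord, List.length_append] at hlen hlen'
    have hvM := hshort v ⟨w₁, wordInv v' ++ w₂, by simp⟩ hc.2.1
    have hvM' := hshort (wordInv v') ⟨w₁ ++ v, w₂, by simp⟩ (isChain_wordInv hc'.2.1)
    rw [length_wordInv] at hvM'
    have hvp := List.length_pos_of_ne_nil hv
    have hvp' := List.length_pos_of_ne_nil hv'
    have hu : u ≠ [] := by rintro rfl; simp at hlen; omega
    have hu' : u' ≠ [] := by rintro rfl; simp at hlen'; omega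
    refine omega_and_starDecomp_of_replace hdih hΩ hL hv (wordInv_ne_nil hv')
      (wordInv_ne_nil hu) hu' hc.2.1 (isChain_wordInv hc'.2.1) (isChain_wordInv hc.1) hc'.1
      (by rw [length_wordInv]; omega) (by omega) ?_ ?_ ?_ ?_
    · rw [head?_wordInv]
      intro l hlw a ha b hb
      obtain ⟨b, hb', rfl⟩ := Option.mem_map.1 hb
      have hab := hc.2.2 b hb' a ha
      refine ⟨hab.2.symm, by simp [hab.1], ?_⟩
      rintro rfl
      exact hl.ne_of_mem_getLast? hb' hlw (by simp)
    · rw [getLast?_wordInv]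
      intro l hlw a ha b hb
      obtain ⟨a, ha', rfl⟩ := Option.mem_map.1 ha
      have hab := hc'.2.2 b hb a ha'
      refine ⟨hab.2.symm, by simp [hab.1], ?_⟩
      rintro rfl
      exact hr.ne_of_mem_getLast? hb (by rw [getLast?_wordInv, hlw]; simp) rfl
    · rw [head?_wordInv]
      intro a ha b hb
      obtain ⟨b, hb', rfl⟩ := Option.mem_map.1 hb
      simp [hpos.2 a (List.mem_of_mem_getLast? ha), hpos'.2 b (List.mem_of_mem_getLast? hb')]
    · rw [getLast?_wordInv]
      intro a ha b hb
      obtain ⟨a, ha', rfl⟩ := Option.mem_map.1 ha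
      exact ⟨hhead a ha' b hb, by
        simp [hpos.1 a (List.mem_of_mem_head? ha'), hpos'.1 b (List.mem_of_mem_head? hb)]⟩

end ArtinTits
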